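/- Suppose A_1, …, A_r are stable and A_{r+1}, …, A_k are unstable (1 ≤ r < k), and let s_1, …, s_p be the simple loops of G. For each simple loop s_i set ρ_i = Π_{(u,v)∈E(s_i)} ‖P_v⁻¹P_u‖, λ_{s_i} = min{λ_u : (u,v) ∈ E(s_i), u ∈ {1,…,r}}, and μ_{s_i} = max{μ_u : (u,v) ∈ E(s_i), u ∈ {r+1,…,k}}. Let τ_i, η_i > 0 satisfy ln ρ_i − λ_{s_i}·τ_i + μ_{s_i}·η_i < 0 for every i (the term −λ_{s_i}τ_i being absent when s_i has no vertex in {1,…,r}, and the term μ_{s_i}η_i being absent when s_i has no vertex in {r+1,…,k}). Let σ be a G-admissible signal admitting nested decompositions: for every m ≥ 1, a partition of the edge-index set {1, …, m−1} of the path σ_1⋯σ_m (where edge j is (σ_j, σ_{j+1}) and carries duration t_j − t_{j−1}) into blocks, each of which traces in increasing order of indices the consecutive edges of some simple loop s_i of G with total duration over its edges (u,v) with u ∈ {1,…,r} at least τ_i and total duration over its edges (u,v) with u ∈ {r+1,…,k} at most η_i, plus at most one residual block of at most k−1 indices, and such that every loop block of the partition for m is also a block of the partition for m+1. Then the switched system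 is asymptotically stable for σ. -/

import Mathlib

open Matrix Filter Topology Finset

attribute [local instance] Classical.propDecidable

noncomputable section

/-- The spectral (ℓ² operator) norm of a complex square matrix. -/
def sNorm {n : ℕ} (M : Matrix (Fin n) (Fin n) ℂ) : ℝ :=
  ‖Matrix.toEuclideanCLM (𝕜 := ℂ) M‖

/-- The spectral (ℓ² operator) norm of a real square matrix. -/
def sNormR {n : ℕ} (M : Matrix (Fin n) (Fin n) ℝ) : ℝ :=
  ‖Matrix.toEuclideanCLM (𝕜 := ℝ) M‖

/-- The ordered product `exp(A_{σ_m}(t_m - t_{m-1})) ⋯ exp(A_{σ_1} t_1)` of the switched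
system (0-based: `flow A t v m = exp((t m - t (m-1)) • A (v (m-1))) * ⋯ * exp((t 1 - t 0) • A (v 0))`). -/
def flow {n k : ℕ} (A : Fin k → Matrix (Fin n) (Fin n) ℝ)
    (t : ℕ → ℝ) (v : ℕ → Fin k) : ℕ → Matrix (Fin n) (Fin n) ℝ
  | 0 => 1
  | m + 1 => NormedSpace.exp ((t (m + 1) - t m) • A (v m)) * flow A t v m

/-- Piecewise evaluation: the value `f m` on the interval `[t m, t (m+1))`. -/
def pc {α : Type*} (t : ℕ → ℝ) (f : ℕ → α) (d : α) (s : ℝ) : α :=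
  if h : ∃ m, t m ≤ s ∧ s < t (m + 1) then f h.choose else d

/-- The solution of the switched system `x' = A_{σ(t)} x`, `x(0) = x0`:
for `s ∈ [t m, t (m+1))`, `x(s) = exp((s - t m) • A (v m)) * flow A t v m * x0`. -/
def sol {n k : ℕ} (A : Fin k → Matrix (Fin n) (Fin n) ℝ)
    (t : ℕ → ℝ) (v : ℕ → Fin k) (x0 : EuclideanSpace ℝ (Fin n)) (s : ℝ) :
    EuclideanSpace ℝ (Fin n) :=
  pc t (fun m => Matrix.toEuclideanCLM (𝕜 := ℝ)
    (NormedSpace.exp ((s - t m) • A (v m)) * flow A t v m) x0) 0 s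

/-- A `G`-admissible switching signal: `t 0 = 0`, strictly increasing switching times tending
to infinity, and consecutive vertices joined by edges of `G`.  Here `v m` is the vertex active
on `[t m, t (m+1))` (i.e. `v m = σ_{m+1}` in 1-based notation). -/
def Admissible {k : ℕ} (E : Set (Fin k × Fin k)) (t : ℕ → ℝ) (v : ℕ → Fin k) : Prop :=
  t 0 = 0 ∧ StrictMono t ∧ Tendsto t atTop atTop ∧ ∀ m, (v m, v (m + 1)) ∈ E

/-- A real matrix is stable if all its (complex) eigenvalues have negative real part. -/
def MStable {n : ℕ} (M : Matrix (Fin n) (Fin n) ℝ) : Prop :=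
  ∀ z ∈ spectrum ℂ (M.map (Complex.ofReal)), z.re < 0

/-- A real matrix is unstable if some eigenvalue has positive real part and no eigenvalue has
zero real part. -/
def MUnstable {n : ℕ} (M : Matrix (Fin n) (Fin n) ℝ) : Prop :=
  (∃ z ∈ spectrum ℂ (M.map (Complex.ofReal)), 0 < z.re) ∧
    ∀ z ∈ spectrum ℂ (M.map (Complex.ofReal)), z.re ≠ 0

/-- `a` is the maximum of the real parts of the eigenvalues of `M`. -/
def MaxRe {n : ℕ} (M : Matrix (Fin n) (Fin n) ℝ) (a : ℝ) : Prop :=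
  IsGreatest (Complex.re '' spectrum ℂ (M.map (Complex.ofReal))) a

/-- `M = P D P⁻¹` with `P` invertible and `D` diagonal (diagonalizability over `ℂ`). -/
def Diagonalized {n : ℕ} (M : Matrix (Fin n) (Fin n) ℝ)
    (P D : Matrix (Fin n) (Fin n) ℂ) : Prop :=
  IsUnit P ∧ D.IsDiag ∧ M.map (Complex.ofReal) = P * D * P⁻¹

/-- Asymptotic stability of the switched system for the given signal. -/
def AsympStable {n k : ℕ} (A : Fin k → Matrix (Fin n) (Fin n) ℝ)
    (t : ℕ → ℝ) (v : ℕ → Fin k) : Prop :=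
  ∀ x0 : EuclideanSpace ℝ (Fin n), Tendsto (fun s => ‖sol A t v x0 s‖) atTop (𝓝 0)

/-- Membership in the class `S_G(τ, η)`: dwell time at least `τ` in the stable subsystems
(indices `< r`), flee time at most `η` in the unstable subsystems (indices `≥ r`). -/
def InSG {k : ℕ} (r : ℕ) (τ η : ℝ) (t : ℕ → ℝ) (v : ℕ → Fin k) : Prop :=
  ∀ m, ((v m).1 < r → τ ≤ t (m + 1) - t m) ∧ (r ≤ (v m).1 → t (m + 1) - t m ≤ η)

end

/-- A simple loop of the digraph with edge set `E`: a directed closed path of length `len ≥ 1`,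
presented as a `len`-periodic vertex sequence, all of whose vertices (within one period) are
distinct, whose consecutive vertices are joined by edges of `E`. -/
structure SimpleLoop (k : ℕ) (E : Set (Fin k × Fin k)) : Type where
  len : ℕ
  pos : 0 < len
  vtx : ℕ → Fin k
  periodic : ∀ j, vtx (j + len) = vtx j
  inj : ∀ a b, a < len → b < len → vtx a = vtx b → a = b
  edge : ∀ j, (vtx j, vtx (j + 1)) ∈ E

/-- The edge set of a simple loop. -/
def loopEdges {k : ℕ} {E : Set (Fin k × Fin k)} (c : SimpleLoop k E) : Set (Fin k × Fin k) :=
  {e | ∃ j < c.len, e = (c.vtx j, c.vtx (j + 1))}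

lemma sNorm_mul_le {n : ℕ} (M N : Matrix (Fin n) (Fin n) ℂ) :
    sNorm (M * N) ≤ sNorm M * sNorm N := by
  unfold sNorm
  rw [map_mul]
  exact norm_mul_le _ _

lemma sNorm_nonneg {n : ℕ} (M : Matrix (Fin n) (Fin n) ℂ) : 0 ≤ sNorm M := norm_nonneg _

lemma sNorm_pos {n : ℕ} (hn : 0 < n) (M : Matrix (Fin n) (Fin n) ℂ) (hM : IsUnit M) :
    0 < sNorm M := by
  have : Nonempty (Fin n) := ⟨⟨0, hn⟩⟩
  unfold sNorm
  rw [norm_pos_iff]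
  intro h
  have : M = 0 := by
    apply (Matrix.toEuclideanCLM (𝕜 := ℂ) (n := Fin n)).injective
    exact h.trans (map_zero _).symm
  rw [this] at hM
  exact not_isUnit_zero hM

lemma sNorm_diagonal_le {n : ℕ} (d : Fin n → ℂ) (c : ℝ) (hc : 0 ≤ c) (h : ∀ i, ‖d i‖ ≤ c) :
    sNorm (Matrix.diagonal d) ≤ c := by
  have := Matrix.l2_opNorm_diagonal (𝕜 := ℂ) d
  unfold sNorm
  rw [Matrix.l2_opNorm_toEuclideanCLM, this]
  exact (pi_norm_le_iff_of_nonneg hc).2 h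

lemma exp_map_ofReal {n : ℕ} (M : Matrix (Fin n) (Fin n) ℝ) :
    (NormedSpace.exp M).map Complex.ofReal = NormedSpace.exp (M.map Complex.ofReal) := by
  have hc : Continuous (fun M : Matrix (Fin n) (Fin n) ℝ => M.map Complex.ofReal) :=
    Continuous.matrix_map continuous_id Complex.continuous_ofReal
  have hcs : @CompleteSpace (Matrix (Fin n) (Fin n) ℝ)
      (Matrix.linftyOpNormedRing (n := Fin n) (α := ℝ)).toPseudoMetricSpace.toUniformSpace := by
    change CompleteSpace (Fin n → Fin n → ℝ)
    infer_instance
  have := @NormedSpace.map_exp (Matrix (Fin n) (Fin n) ℝ) (Matrix (Fin n) (Fin n) ℂ)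
    Matrix.linftyOpNormedRing Matrix.linftyOpNormedAlgebra hcs Matrix.linftyOpNormedRing
    inferInstance _ _ _ (Complex.ofRealHom.mapMatrix (m := Fin n)) hc M
  exact this

lemma norm_real_le {n : ℕ} (M : Matrix (Fin n) (Fin n) ℝ) (x : EuclideanSpace ℝ (Fin n)) :
    ‖Matrix.toEuclideanCLM (𝕜 := ℝ) M x‖ ≤ sNorm (M.map Complex.ofReal) * ‖x‖ := by
  let y : EuclideanSpace ℂ (Fin n) := WithLp.toLp 2 (fun i => (x i : ℂ))
  have hy : ‖y‖ = ‖x‖ := by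
    simp [EuclideanSpace.norm_eq, y]
  have h2 : ‖Matrix.toEuclideanCLM (𝕜 := ℂ) (M.map Complex.ofReal) y‖
      = ‖Matrix.toEuclideanCLM (𝕜 := ℝ) M x‖ := by
    rw [EuclideanSpace.norm_eq, EuclideanSpace.norm_eq]
    congr 1
    apply Finset.sum_congr rfl
    intro i _
    have : (Matrix.toEuclideanCLM (𝕜 := ℂ) (M.map Complex.ofReal) y) i
        = (((Matrix.toEuclideanCLM (𝕜 := ℝ) M x) i : ℝ) : ℂ) := by
      simp [Matrix.ofLp_toEuclideanCLM, Matrix.mulVec, dotProduct, y]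
    rw [this, Complex.norm_real]
  rw [← h2, ← hy]
  exact ContinuousLinearMap.le_opNorm _ _

lemma exp_diag_form {n : ℕ} (M : Matrix (Fin n) (Fin n) ℝ) (P D : Matrix (Fin n) (Fin n) ℂ)
    (h : Diagonalized M P D) (c : ℝ) :
    (NormedSpace.exp (c • M)).map Complex.ofReal
      = P * NormedSpace.exp ((c : ℂ) • D) * P⁻¹ := by
  obtain ⟨hP, hD, hM⟩ := h
  rw [exp_map_ofReal]
  have : (c • M).map Complex.ofReal = P * ((c : ℂ) • D) * P⁻¹ := by
    rw [Matrix.mul_smul, Matrix.smul_mul, ← hM]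
    ext i j
    simp
  rw [this, Matrix.exp_conj _ _ hP]

lemma sNorm_exp_le {n : ℕ} (M : Matrix (Fin n) (Fin n) ℝ) (P D : Matrix (Fin n) (Fin n) ℂ)
    (h : Diagonalized M P D) (a : ℝ) (ha : MaxRe M a) (c : ℝ) (hc : 0 ≤ c) :
    sNorm (NormedSpace.exp ((c : ℂ) • D)) ≤ Real.exp (a * c) := by
  obtain ⟨hP, hD, hM⟩ := h
  obtain ⟨d, rfl⟩ : ∃ d, D = Matrix.diagonal d := ⟨_, hD.diagonal_diag.symm⟩
  have hs : spectrum ℂ (M.map Complex.ofReal) = Set.range d := by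
    obtain ⟨u, rfl⟩ := hP
    rw [hM, ← Matrix.coe_units_inv, spectrum.units_conjugate, spectrum_diagonal]
  rw [← Matrix.diagonal_smul, Matrix.exp_diagonal]
  apply sNorm_diagonal_le _ _ (Real.exp_pos _).le
  intro i
  have hi : (d i).re ≤ a := ha.2 ⟨d i, by rw [hs]; exact ⟨i, rfl⟩, rfl⟩
  rw [Pi.coe_exp, ← Complex.exp_eq_exp_ℂ, Complex.norm_exp]
  apply Real.exp_le_exp.2
  simp only [Pi.smul_apply, smul_eq_mul, Complex.re_ofReal_mul]
  nlinarith

/-- The basic growth bound for the transformed flow. -/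
lemma flow_bound {n k : ℕ} (A : Fin k → Matrix (Fin n) (Fin n) ℝ)
    (P D : Fin k → Matrix (Fin n) (Fin n) ℂ)
    (hdiag : ∀ i, Diagonalized (A i) (P i) (D i)) (α : Fin k → ℝ) (hα : ∀ i, MaxRe (A i) (α i))
    (t : ℕ → ℝ) (v : ℕ → Fin k) (ht : StrictMono t) (m : ℕ) :
    sNorm ((P (v m))⁻¹ * (flow A t v m).map Complex.ofReal)
      ≤ (∏ j ∈ Finset.range m, sNorm ((P (v (j + 1)))⁻¹ * P (v j))
          * Real.exp (α (v j) * (t (j + 1) - t j))) * sNorm ((P (v 0))⁻¹) := by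
  induction m with
  | zero => simp [flow]
  | succ m ih =>
    have h1 : (P (v (m + 1)))⁻¹ * (flow A t v (m + 1)).map Complex.ofReal
        = ((P (v (m + 1)))⁻¹ * P (v m)) * NormedSpace.exp (((t (m + 1) - t m : ℝ) : ℂ) • D (v m))
          * ((P (v m))⁻¹ * (flow A t v m).map Complex.ofReal) := by
      have : (flow A t v (m + 1)).map Complex.ofReal
          = (NormedSpace.exp ((t (m + 1) - t m) • A (v m))).map Complex.ofReal
            * (flow A t v m).map Complex.ofReal := by
        rw [flow]
        exact Matrix.map_mul (f := Complex.ofRealHom)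
      rw [this, exp_diag_form _ _ _ (hdiag (v m))]
      simp only [Matrix.mul_assoc]
    rw [h1, Finset.prod_range_succ]
    have h0 : 0 ≤ t (m + 1) - t m := sub_nonneg.2 (ht (Nat.lt_succ_self m)).le
    have h2 := sNorm_exp_le _ _ _ (hdiag (v m)) _ (hα (v m)) _ h0
    calc _ ≤ (sNorm ((P (v (m + 1)))⁻¹ * P (v m))
            * Real.exp (α (v m) * (t (m + 1) - t m)))
            * sNorm ((P (v m))⁻¹ * (flow A t v m).map Complex.ofReal) := by
          refine (sNorm_mul_le _ _).trans ?_
          refine mul_le_mul_of_nonneg_right ?_ (sNorm_nonneg _)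
          refine (sNorm_mul_le _ _).trans ?_
          exact mul_le_mul_of_nonneg_left h2 (sNorm_nonneg _)
      _ ≤ _ := by
          refine (mul_le_mul_of_nonneg_left ih
            (mul_nonneg (sNorm_nonneg _) (Real.exp_pos _).le)).trans (le_of_eq ?_)
          ring

lemma sol_bound {n k : ℕ} (A : Fin k → Matrix (Fin n) (Fin n) ℝ)
    (P D : Fin k → Matrix (Fin n) (Fin n) ℂ)
    (hdiag : ∀ i, Diagonalized (A i) (P i) (D i)) (α : Fin k → ℝ) (hα : ∀ i, MaxRe (A i) (α i))
    (t : ℕ → ℝ) (v : ℕ → Fin k) (ht : StrictMono t) (m : ℕ) (x0 : EuclideanSpace ℝ (Fin n))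
    (s : ℝ) (hs : t m ≤ s) :
    ‖Matrix.toEuclideanCLM (𝕜 := ℝ) (NormedSpace.exp ((s - t m) • A (v m)) * flow A t v m) x0‖
      ≤ sNorm (P (v m)) * Real.exp (α (v m) * (s - t m)) *
        ((∏ j ∈ Finset.range m, sNorm ((P (v (j + 1)))⁻¹ * P (v j))
          * Real.exp (α (v j) * (t (j + 1) - t j))) * sNorm ((P (v 0))⁻¹)) * ‖x0‖ := by
  refine (norm_real_le _ _).trans ?_
  refine mul_le_mul_of_nonneg_right ?_ (norm_nonneg _)
  have h1 : (NormedSpace.exp ((s - t m) • A (v m)) * flow A t v m).map Complex.ofReal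
      = P (v m) * NormedSpace.exp (((s - t m : ℝ) : ℂ) • D (v m))
          * ((P (v m))⁻¹ * (flow A t v m).map Complex.ofReal) := by
    have : (NormedSpace.exp ((s - t m) • A (v m)) * flow A t v m).map Complex.ofReal
          = (NormedSpace.exp ((s - t m) • A (v m))).map Complex.ofReal
            * (flow A t v m).map Complex.ofReal := Matrix.map_mul (f := Complex.ofRealHom)
    rw [this, exp_diag_form _ _ _ (hdiag (v m))]
    simp only [Matrix.mul_assoc]
  rw [h1]
  have h2 := sNorm_exp_le _ _ _ (hdiag (v m)) _ (hα (v m)) _ (sub_nonneg.2 hs)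
  refine (sNorm_mul_le _ _).trans ?_
  refine mul_le_mul ?_ (flow_bound A P D hdiag α hα t v ht m) (sNorm_nonneg _)
    (mul_nonneg (sNorm_nonneg _) (Real.exp_pos _).le)
  exact (sNorm_mul_le _ _).trans (mul_le_mul_of_nonneg_left h2 (sNorm_nonneg _))

lemma prod_periodic_shift (G : ℕ → ℝ) (L : ℕ) (hG : ∀ x, G (x + L) = G x) (o : ℕ) :
    ∏ a ∈ Finset.range L, G (o + a) = ∏ a ∈ Finset.range L, G a := by
  induction o with
  | zero => simp
  | succ o ih =>
    rw [← ih]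
    cases L with
    | zero => simp
    | succ L =>
      rw [Finset.prod_range_succ, Finset.prod_range_succ']
      have h1 : G (o + 1 + L) = G o := by
        rw [← hG o]; congr 1; ring
      rw [h1, Nat.add_zero]
      congr 1
      apply Finset.prod_congr rfl
      intro a _
      congr 1; ring

lemma prod_block {M : Type*} [CommMonoid M] (b : Finset ℕ) (F G : ℕ → M)
    (h : ∀ a : Fin b.card, F ((b.orderIsoOfFin rfl a).1) = G (a : ℕ)) :
    ∏ j ∈ b, F j = ∏ a ∈ Finset.range b.card, G a := by
  rw [← Finset.prod_coe_sort b, Finset.prod_range,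
    ← Equiv.prod_comp (b.orderIsoOfFin rfl).toEquiv (fun x : b => F x.1)]
  exact Finset.prod_congr rfl (fun a _ => h a)

lemma le_univ_sum {ι : Type*} [Fintype ι] (f : ι → ℝ) (hf : ∀ i, 0 ≤ f i) (i : ι) :
    f i ≤ ∑ j, f j :=
  Finset.single_le_sum (f := f) (fun j _ => hf j) (Finset.mem_univ i)

lemma loop_len_le {k : ℕ} {E : Set (Fin k × Fin k)} (c : SimpleLoop k E) : c.len ≤ k := by
  have h : Function.Injective (fun a : Fin c.len => c.vtx a) := by
    intro a b hab
    exact Fin.ext (c.inj a b a.2 b.2 hab)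
  simpa using Fintype.card_le_of_injective _ h

lemma loop_vtx_mod {k : ℕ} {E : Set (Fin k × Fin k)} (c : SimpleLoop k E) (x : ℕ) :
    ∃ j < c.len, c.vtx x = c.vtx j :=
  ⟨x % c.len, Nat.mod_lt _ c.pos,
    ((Function.Periodic.map_mod_nat (f := c.vtx) (a := c.len) c.periodic x)).symm⟩

/-- Contribution of one loop block. -/
lemma block_bound {n k : ℕ} {E : Set (Fin k × Fin k)} (hn : 0 < n) (r : ℕ)
    (P : Fin k → Matrix (Fin n) (Fin n) ℂ) (hP : ∀ i, IsUnit (P i))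
    (lam mu α : Fin k → ℝ)
    (hlampos : ∀ i : Fin k, i.1 < r → 0 < lam i)
    (hmupos : ∀ i : Fin k, r ≤ i.1 → 0 < mu i)
    (hα1 : ∀ i : Fin k, i.1 < r → α i = - lam i)
    (hα2 : ∀ i : Fin k, r ≤ i.1 → α i = mu i)
    (c : SimpleLoop k E) (lamS muS τ η : ℝ)
    (hlamS : (∃ j < c.len, (c.vtx j).1 < r) →
      IsLeast {x : ℝ | ∃ j < c.len, (c.vtx j).1 < r ∧ x = lam (c.vtx j)} lamS)
    (hmuS : (∃ j < c.len, r ≤ (c.vtx j).1) →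
      IsGreatest {x : ℝ | ∃ j < c.len, r ≤ (c.vtx j).1 ∧ x = mu (c.vtx j)} muS)
    (hτ : 0 < τ)
    (t : ℕ → ℝ) (v : ℕ → Fin k) (ht : StrictMono t)
    (b : Finset ℕ) (o : ℕ) (hb : b.card = c.len)
    (hv : ∀ a : Fin b.card,
            v ((b.orderIsoOfFin rfl a).1) = c.vtx (o + (a : ℕ)) ∧
            v ((b.orderIsoOfFin rfl a).1 + 1) = c.vtx (o + (a : ℕ) + 1))
    (hbτ : τ ≤ (∑ j ∈ b.filter (fun j => (v j).1 < r), (t (j + 1) - t j)))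
    (hbη : (∑ j ∈ b.filter (fun j => r ≤ (v j).1), (t (j + 1) - t j)) ≤ η) :
    ∏ j ∈ b, sNorm ((P (v (j + 1)))⁻¹ * P (v j)) * Real.exp (α (v j) * (t (j + 1) - t j))
      ≤ Real.exp (Real.log (∏ j ∈ Finset.range c.len,
          sNorm ((P (c.vtx (j + 1)))⁻¹ * P (c.vtx j))) -
        (if ∃ j < c.len, (c.vtx j).1 < r then lamS * τ else 0) +
        (if ∃ j < c.len, r ≤ (c.vtx j).1 then muS * η else 0)) := by
  have hd : ∀ j, 0 ≤ t (j + 1) - t j := fun j => sub_nonneg.2 (ht (Nat.lt_succ_self j)).le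
  have hmem : ∀ j ∈ b, ∃ x < c.len, v j = c.vtx x := by
    intro j hj
    obtain ⟨a, ha⟩ := (b.orderIsoOfFin rfl).surjective ⟨j, hj⟩
    have h1 := (hv a).1
    rw [ha] at h1
    obtain ⟨x, hx, hxe⟩ := loop_vtx_mod c (o + a)
    exact ⟨x, hx, h1.trans hxe⟩
  have hprod : ∏ j ∈ b, sNorm ((P (v (j + 1)))⁻¹ * P (v j))
      = ∏ j ∈ Finset.range c.len, sNorm ((P (c.vtx (j + 1)))⁻¹ * P (c.vtx j)) := by
    rw [prod_block b (fun j => sNorm ((P (v (j + 1)))⁻¹ * P (v j)))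
      (fun a => (fun x => sNorm ((P (c.vtx (x + 1)))⁻¹ * P (c.vtx x))) (o + a)) ?_, hb,
      prod_periodic_shift (fun x => sNorm ((P (c.vtx (x + 1)))⁻¹ * P (c.vtx x)))]
    · intro x
      rw [show x + c.len + 1 = (x + 1) + c.len by ring, c.periodic, c.periodic]
    · intro a
      simp only
      rw [(hv a).1, (hv a).2]
  have hpos : 0 < ∏ j ∈ Finset.range c.len, sNorm ((P (c.vtx (j + 1)))⁻¹ * P (c.vtx j)) := by
    apply Finset.prod_pos
    intro j _
    apply sNorm_pos hn
    exact ((Matrix.isUnit_nonsing_inv_iff).2 (hP _)).mul (hP _)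
  rw [Finset.prod_mul_distrib, hprod, ← Real.exp_sum, add_comm_sub, Real.exp_add,
    Real.exp_log hpos]
  refine mul_le_mul_of_nonneg_left (Real.exp_le_exp.2 ?_) hpos.le
  have hsplit : ∑ j ∈ b, α (v j) * (t (j + 1) - t j)
      = (∑ j ∈ b.filter (fun j => (v j).1 < r), α (v j) * (t (j + 1) - t j))
        + ∑ j ∈ b.filter (fun j => r ≤ (v j).1), α (v j) * (t (j + 1) - t j) := by
    rw [← Finset.sum_filter_add_sum_filter_not b (fun j => (v j).1 < r)]
    simp only [not_lt]
  have hS : ∑ j ∈ b.filter (fun j => (v j).1 < r), α (v j) * (t (j + 1) - t j)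
      ≤ - (if ∃ j < c.len, (c.vtx j).1 < r then lamS * τ else 0) := by
    split_ifs with hex
    · obtain ⟨⟨x, hx, hxr, hxe⟩, hleast⟩ := hlamS hex
      have hlp : 0 < lamS := hxe ▸ hlampos _ hxr
      calc _ ≤ ∑ j ∈ b.filter (fun j => (v j).1 < r), (-lamS) * (t (j + 1) - t j) := by
            apply Finset.sum_le_sum
            intro j hj
            rw [Finset.mem_filter] at hj
            obtain ⟨y, hy, hye⟩ := hmem j hj.1
            have : lamS ≤ lam (v j) := hleast ⟨y, hy, hye ▸ hj.2, by rw [hye]⟩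
            rw [hα1 _ hj.2]
            exact mul_le_mul_of_nonneg_right (by linarith) (hd j)
        _ = -lamS * ∑ j ∈ b.filter (fun j => (v j).1 < r), (t (j + 1) - t j) := by
            rw [Finset.mul_sum]
        _ ≤ _ := by nlinarith
    · exfalso
      have : b.filter (fun j => (v j).1 < r) = ∅ := by
        apply Finset.filter_eq_empty_iff.2
        intro j hj hjr
        obtain ⟨y, hy, hye⟩ := hmem j hj
        exact hex ⟨y, hy, hye ▸ hjr⟩
      rw [this, Finset.sum_empty] at hbτ
      linarith
  have hU : ∑ j ∈ b.filter (fun j => r ≤ (v j).1), α (v j) * (t (j + 1) - t j)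
      ≤ (if ∃ j < c.len, r ≤ (c.vtx j).1 then muS * η else 0) := by
    split_ifs with hex
    · obtain ⟨⟨x, hx, hxr, hxe⟩, hgr⟩ := hmuS hex
      have hlp : 0 < muS := hxe ▸ hmupos _ hxr
      calc _ ≤ ∑ j ∈ b.filter (fun j => r ≤ (v j).1), muS * (t (j + 1) - t j) := by
            apply Finset.sum_le_sum
            intro j hj
            rw [Finset.mem_filter] at hj
            obtain ⟨y, hy, hye⟩ := hmem j hj.1
            have : mu (v j) ≤ muS := hgr ⟨y, hy, hye ▸ hj.2, by rw [hye]⟩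
            rw [hα2 _ hj.2]
            exact mul_le_mul_of_nonneg_right this (hd j)
        _ = muS * ∑ j ∈ b.filter (fun j => r ≤ (v j).1), (t (j + 1) - t j) := by
            rw [Finset.mul_sum]
        _ ≤ _ := mul_le_mul_of_nonneg_left hbη hlp.le
    · have : b.filter (fun j => r ≤ (v j).1) = ∅ := by
        apply Finset.filter_eq_empty_iff.2
        intro j hj hjr
        obtain ⟨y, hy, hye⟩ := hmem j hj
        exact hex ⟨y, hy, hye ▸ hjr⟩
      rw [this, Finset.sum_empty]
  rw [hsplit]
  linarith

set_option maxHeartbeats 1000000 in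
/-- simple loop dwell/flee times, stable and unstable subsystems: `s_1,…,s_p`
are the simple loops of `G`; `λ_{s_i}` (resp. `μ_{s_i}`) is the minimum of the `λ_u` (resp.
maximum of the `μ_u`) over sources `u` of edges of `s i` with `u` stable (resp. unstable),
and `ln ρ_i − λ_{s_i}τ_i + μ_{s_i}η_i < 0` for every `i`, the corresponding term being
absent when `s i` has no stable (resp. unstable) vertex.  Suppose the signal admits nested
standard decompositions: for every `m ≥ 1` a partition of the edge-index set `{0,…,m-2}` of
`σ_1⋯σ_m` into loop blocks — each tracing in increasing order the consecutive edges of some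
simple loop `s i` with total duration over stable-source edges at least `τ i` and over
unstable-source edges at most `η i` — plus at most one residual block of at most `k - 1`
indices, with every loop block for `m` also a loop block for `m + 1`.  Then the switched
system is asymptotically stable. -/
theorem stability_simple_loop_dwell_flee_time {n k p : ℕ} (E : Set (Fin k × Fin k))
    (r : ℕ) (hr : 1 ≤ r) (hrk : r < k)
    (A : Fin k → Matrix (Fin n) (Fin n) ℝ) (P D : Fin k → Matrix (Fin n) (Fin n) ℂ)
    (hdiag : ∀ i, Diagonalized (A i) (P i) (D i))
    (hstab : ∀ i : Fin k, i.1 < r → MStable (A i))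
    (hunst : ∀ i : Fin k, r ≤ i.1 → MUnstable (A i))
    (lam mu : Fin k → ℝ)
    (hlam : ∀ i : Fin k, i.1 < r → MaxRe (A i) (-(lam i)))
    (hmu : ∀ i : Fin k, r ≤ i.1 → MaxRe (A i) (mu i))
    (s : Fin p → SimpleLoop k E)
    (hcomplete : ∀ c : SimpleLoop k E, ∃ i : Fin p, loopEdges c = loopEdges (s i))
    (lamS muS : Fin p → ℝ)
    (hlamS : ∀ i : Fin p, (∃ j < (s i).len, ((s i).vtx j).1 < r) →
      IsLeast {x : ℝ | ∃ j < (s i).len, ((s i).vtx j).1 < r ∧ x = lam ((s i).vtx j)} (lamS i))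
    (hmuS : ∀ i : Fin p, (∃ j < (s i).len, r ≤ ((s i).vtx j).1) →
      IsGreatest {x : ℝ | ∃ j < (s i).len, r ≤ ((s i).vtx j).1 ∧ x = mu ((s i).vtx j)} (muS i))
    (τ η : Fin p → ℝ) (hτpos : ∀ i, 0 < τ i) (hηpos : ∀ i, 0 < η i)
    (hcond : ∀ i : Fin p,
      Real.log (∏ j ∈ Finset.range (s i).len,
          sNorm ((P ((s i).vtx (j + 1)))⁻¹ * P ((s i).vtx j))) -
        (if ∃ j < (s i).len, ((s i).vtx j).1 < r then lamS i * τ i else 0) +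
        (if ∃ j < (s i).len, r ≤ ((s i).vtx j).1 then muS i * η i else 0) < 0)
    (t : ℕ → ℝ) (v : ℕ → Fin k) (hadm : Admissible E t v)
    (hdec : ∃ (B : ℕ → Finset (Finset ℕ)) (R : ℕ → Finset ℕ),
      (∀ m : ℕ, B m ⊆ B (m + 1)) ∧
      ∀ m : ℕ, 1 ≤ m →
        Set.PairwiseDisjoint (B m : Set (Finset ℕ)) id ∧
        (∀ b ∈ B m, Disjoint b (R m)) ∧
        R m ∪ (B m).biUnion id = Finset.range (m - 1) ∧
        (R m).card ≤ k - 1 ∧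
        (∀ b ∈ B m, ∃ (i : Fin p) (o : ℕ) (hb : b.card = (s i).len),
          (∀ a : Fin b.card,
            v ((b.orderIsoOfFin rfl a).1) = (s i).vtx (o + (a : ℕ)) ∧
            v ((b.orderIsoOfFin rfl a).1 + 1) = (s i).vtx (o + (a : ℕ) + 1)) ∧
          τ i ≤ (∑ j ∈ b.filter (fun j => (v j).1 < r), (t (j + 1) - t j)) ∧
          (∑ j ∈ b.filter (fun j => r ≤ (v j).1), (t (j + 1) - t j)) ≤ η i)) :
    AsympStable A t v := by
  intro x0
  rcases Nat.eq_zero_or_pos n with rfl | hn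
  · have : ∀ s, ‖sol A t v x0 s‖ = 0 := fun s => by
      rw [Subsingleton.elim (sol A t v x0 s) 0, norm_zero]
    simp only [this]
    exact tendsto_const_nhds
  obtain ⟨-, ht, -, -⟩ := hadm
  obtain ⟨B, R, hnest, hB⟩ := hdec
  have hk : 0 < k := by omega
  have hd : ∀ j, 0 ≤ t (j + 1) - t j := fun j => sub_nonneg.2 (ht (Nat.lt_succ_self j)).le
  have hlampos : ∀ i : Fin k, i.1 < r → 0 < lam i := by
    intro i hi
    obtain ⟨z, hz, hze⟩ := (hlam i hi).1
    have := hstab i hi z hz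
    linarith
  have hmupos : ∀ i : Fin k, r ≤ i.1 → 0 < mu i := by
    intro i hi
    obtain ⟨z, hz, hzp⟩ := (hunst i hi).1
    exact hzp.trans_le ((hmu i hi).2 ⟨z, hz, rfl⟩)
  obtain ⟨α, hα1, hα2⟩ : ∃ α : Fin k → ℝ, (∀ i : Fin k, i.1 < r → α i = - lam i) ∧
      (∀ i : Fin k, r ≤ i.1 → α i = mu i) :=
    ⟨fun i => if i.1 < r then - lam i else mu i, fun i hi => if_pos hi,
      fun i hi => if_neg (not_lt.2 hi)⟩
  have hα : ∀ i, MaxRe (A i) (α i) := by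
    intro i
    rcases lt_or_ge i.1 r with hi | hi
    · rw [hα1 i hi]; exact hlam i hi
    · rw [hα2 i hi]; exact hmu i hi
  -- a uniform contraction factor for loop blocks
  obtain ⟨q, hq0, hq1, hq⟩ : ∃ q : ℝ, 0 < q ∧ q < 1 ∧ ∀ i : Fin p,
      Real.exp (Real.log (∏ j ∈ Finset.range (s i).len,
          sNorm ((P ((s i).vtx (j + 1)))⁻¹ * P ((s i).vtx j))) -
        (if ∃ j < (s i).len, ((s i).vtx j).1 < r then lamS i * τ i else 0) +
        (if ∃ j < (s i).len, r ≤ ((s i).vtx j).1 then muS i * η i else 0)) ≤ q := by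
    have h1 : ∀ᶠ q in 𝓝[<] (1 : ℝ), ∀ i : Fin p,
      Real.exp (Real.log (∏ j ∈ Finset.range (s i).len,
          sNorm ((P ((s i).vtx (j + 1)))⁻¹ * P ((s i).vtx j))) -
        (if ∃ j < (s i).len, ((s i).vtx j).1 < r then lamS i * τ i else 0) +
        (if ∃ j < (s i).len, r ≤ ((s i).vtx j).1 then muS i * η i else 0)) ≤ q := by
      rw [eventually_all]
      intro i
      have := (Real.exp_lt_exp.2 (hcond i)).trans_eq Real.exp_zero
      exact (eventually_ge_nhds this).filter_mono nhdsWithin_le_nhds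
    have h2 : ∀ᶠ q in 𝓝[<] (1 : ℝ), 0 < q :=
      (eventually_gt_nhds one_pos).filter_mono nhdsWithin_le_nhds
    have h3 : ∀ᶠ q in 𝓝[<] (1 : ℝ), q < 1 := eventually_mem_nhdsWithin
    obtain ⟨q, h1, h2, h3⟩ := (h1.and (h2.and h3)).exists
    exact ⟨q, h2, h3, h1⟩
  -- unstable durations are bounded
  obtain ⟨H, hH0, hH⟩ : ∃ H : ℝ, 0 ≤ H ∧ ∀ j, r ≤ (v j).1 → t (j + 1) - t j ≤ H := by
    have hfin : {j : ℕ | ∀ m, ∀ b ∈ B m, j ∉ b}.Finite := by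
      by_contra hinf
      obtain ⟨S, hS, hcard⟩ := Set.Infinite.exists_subset_card_eq hinf k
      obtain ⟨-, -, hun, hRc, -⟩ := hB (S.sup id + 2) (by omega)
      have hsub : S ⊆ R (S.sup id + 2) := by
        intro j hj
        have hle : j ≤ S.sup id := Finset.le_sup (f := id) hj
        have : j ∈ R (S.sup id + 2) ∪ (B (S.sup id + 2)).biUnion id := by
          rw [hun, Finset.mem_range]; omega
        rcases Finset.mem_union.1 this with h | h
        · exact h
        · obtain ⟨b, hb, hjb⟩ := Finset.mem_biUnion.1 h
          exact absurd hjb (hS hj _ b hb)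
      have := Finset.card_le_card hsub
      omega
    have hη0 : 0 ≤ ∑ i, η i := Finset.sum_nonneg fun i _ => (hηpos i).le
    have hf0 : 0 ≤ ∑ j ∈ hfin.toFinset, (t (j + 1) - t j) := Finset.sum_nonneg fun j _ => hd j
    refine ⟨(∑ j ∈ hfin.toFinset, (t (j + 1) - t j)) + ∑ i, η i, add_nonneg hf0 hη0, ?_⟩
    intro j hj
    by_cases hjU : ∀ m, ∀ b ∈ B m, j ∉ b
    · have : t (j + 1) - t j ≤ ∑ j ∈ hfin.toFinset, (t (j + 1) - t j) :=
        Finset.single_le_sum (f := fun j => t (j + 1) - t j) (fun j _ => hd j)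
          (hfin.mem_toFinset.2 hjU)
      linarith
    · push Not at hjU
      obtain ⟨m, b, hb, hjb⟩ := hjU
      obtain ⟨i, o, -, -, -, hbη⟩ := (hB (m + 1) (by omega)).2.2.2.2 b (hnest m hb)
      have h1 : t (j + 1) - t j ≤ ∑ j ∈ b.filter (fun j => r ≤ (v j).1), (t (j + 1) - t j) :=
        Finset.single_le_sum (f := fun j => t (j + 1) - t j) (fun j _ => hd j)
          (Finset.mem_filter.2 ⟨hjb, hj⟩)
      have h2 : η i ≤ ∑ i, η i :=
        Finset.single_le_sum (fun i _ => (hηpos i).le) (Finset.mem_univ i)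
      linarith
  -- uniform bound on exponential factors
  have hexp : ∀ (u : Fin k) (c : ℝ), 0 ≤ c → (r ≤ u.1 → c ≤ H) →
      Real.exp (α u * c) ≤ Real.exp ((∑ w, |α w|) * H) := by
    intro u c hc hcH
    apply Real.exp_le_exp.2
    have hM : |α u| ≤ ∑ w, |α w| :=
      Finset.single_le_sum (f := fun w => |α w|) (fun w _ => abs_nonneg _) (Finset.mem_univ u)
    have hM0 : 0 ≤ ∑ w, |α w| := (abs_nonneg _).trans hM
    rcases lt_or_ge u.1 r with hu | hu
    · have h1 : α u * c ≤ 0 := by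
        rw [hα1 u hu]
        have := hlampos u hu
        nlinarith
      exact h1.trans (mul_nonneg hM0 hH0)
    · calc α u * c ≤ |α u| * c := mul_le_mul_of_nonneg_right (le_abs_self _) hc
        _ ≤ (∑ w, |α w|) * H := mul_le_mul hM (hcH hu) hc hM0
  obtain ⟨L, hLpos, hexp⟩ : ∃ L : ℝ, 0 < L ∧ ∀ (u : Fin k) (c : ℝ), 0 ≤ c → (r ≤ u.1 → c ≤ H) →
      Real.exp (α u * c) ≤ L := ⟨_, Real.exp_pos _, hexp⟩
  obtain ⟨g, hg⟩ : ∃ g : ℕ → ℝ, ∀ j, g j = sNorm ((P (v (j + 1)))⁻¹ * P (v j))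
          * Real.exp (α (v j) * (t (j + 1) - t j)) := ⟨_, fun _ => rfl⟩
  have hg0 : ∀ j, 0 ≤ g j := fun j => by
    rw [hg j]; exact mul_nonneg (sNorm_nonneg _) (Real.exp_pos _).le
  obtain ⟨K, hK1, hK⟩ : ∃ K : ℝ, 1 ≤ K ∧ ∀ j, g j ≤ K := by
    refine ⟨(∑ w : Fin k × Fin k, sNorm ((P w.1)⁻¹ * P w.2)) * L + 1, ?_, ?_⟩
    · have : 0 ≤ ∑ w : Fin k × Fin k, sNorm ((P w.1)⁻¹ * P w.2) :=
        Finset.sum_nonneg fun w _ => sNorm_nonneg _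
      have := mul_nonneg this hLpos.le
      linarith
    · intro j
      have h1 : sNorm ((P (v (j + 1)))⁻¹ * P (v j))
          ≤ ∑ w : Fin k × Fin k, sNorm ((P w.1)⁻¹ * P w.2) :=
        le_univ_sum (fun w : Fin k × Fin k => sNorm ((P w.1)⁻¹ * P w.2))
          (fun w => sNorm_nonneg _) (v (j + 1), v j)
      have h2 := hexp (v j) (t (j + 1) - t j) (hd j) (hH j)
      have := mul_le_mul h1 h2 (Real.exp_pos _).le ((sNorm_nonneg _).trans h1)
      rw [hg j]
      linarith
  have hprod : ∀ m, ∏ j ∈ Finset.range m, g j ≤ K ^ (k - 1) * q ^ (B (m + 1)).card := by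
    intro m
    obtain ⟨hdis, hdisR, hun, hRc, hblk⟩ := hB (m + 1) (by omega)
    rw [Nat.add_sub_cancel] at hun
    rw [← hun, Finset.prod_union, Finset.prod_biUnion hdis]
    · refine mul_le_mul ?_ ?_ ?_ (by positivity)
      · calc ∏ j ∈ R (m + 1), g j ≤ ∏ j ∈ R (m + 1), K :=
              Finset.prod_le_prod (fun j _ => hg0 j) (fun j _ => hK j)
          _ = K ^ (R (m + 1)).card := by rw [Finset.prod_const]
          _ ≤ K ^ (k - 1) := pow_le_pow_right₀ hK1 hRc
      · calc ∏ b ∈ B (m + 1), ∏ j ∈ id b, g j ≤ ∏ b ∈ B (m + 1), q := by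
              apply Finset.prod_le_prod (fun b _ => Finset.prod_nonneg fun j _ => hg0 j)
              intro b hb
              obtain ⟨i, o, hbc, hbv, hbτ, hbη⟩ := hblk b hb
              simp only [id, hg]
              exact (block_bound hn r P (fun i => (hdiag i).1) lam mu α hlampos hmupos hα1 hα2
                (s i) (lamS i) (muS i) (τ i) (η i) (hlamS i) (hmuS i) (hτpos i) t v ht b o hbc
                hbv hbτ hbη).trans (hq i)
          _ = q ^ (B (m + 1)).card := by rw [Finset.prod_const]
      · exact Finset.prod_nonneg fun b _ => Finset.prod_nonneg fun j _ => hg0 j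
    · rw [Finset.disjoint_biUnion_right]
      exact fun b hb => (hdisR b hb).symm
  have hcount : Tendsto (fun m => (B (m + 1)).card) atTop atTop := by
    rw [tendsto_atTop]
    intro N
    filter_upwards [eventually_ge_atTop (k + N * k)] with m hm
    obtain ⟨hdis, hdisR, hun, hRc, hblk⟩ := hB (m + 1) (by omega)
    rw [Nat.add_sub_cancel] at hun
    have h1 : m ≤ (R (m + 1)).card + ((B (m + 1)).biUnion id).card := by
      have := Finset.card_union_le (R (m + 1)) ((B (m + 1)).biUnion id)
      rwa [hun, Finset.card_range] at this
    have h2 : ((B (m + 1)).biUnion id).card ≤ (B (m + 1)).card * k := by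
      apply Finset.card_biUnion_le_card_mul
      intro b hb
      obtain ⟨i, o, hbc, -⟩ := hblk b hb
      exact hbc.le.trans (loop_len_le (s i))
    by_contra hlt
    have h3 : (B (m + 1)).card * k ≤ N * k := Nat.mul_le_mul_right k (by omega)
    omega
  obtain ⟨C, hC⟩ : ∃ C : ℝ, C = (∑ u, sNorm (P u)) * L := ⟨_, rfl⟩
  have hbd : Tendsto (fun m => C * ((K ^ (k - 1) * q ^ (B (m + 1)).card)
      * sNorm ((P (v 0))⁻¹)) * ‖x0‖) atTop (𝓝 0) := by
    have h1 : Tendsto (fun m => q ^ (B (m + 1)).card) atTop (𝓝 0) :=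
      (tendsto_pow_atTop_nhds_zero_of_lt_one hq0.le hq1).comp hcount
    have h2 := (((h1.const_mul (K ^ (k - 1))).mul_const (sNorm ((P (v 0))⁻¹))).const_mul C).mul_const
      ‖x0‖
    simpa using h2
  rw [Metric.tendsto_atTop]
  intro ε hε
  obtain ⟨M0, hM0⟩ := eventually_atTop.1 (hbd.eventually (gt_mem_nhds hε))
  refine ⟨t M0, fun x hx => ?_⟩
  rw [Real.dist_eq, sub_zero, abs_of_nonneg (norm_nonneg _)]
  unfold sol pc
  split_ifs with hex
  · obtain ⟨hm1, hm2⟩ := hex.choose_spec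
    generalize hex.choose = m at hm1 hm2 ⊢
    have hMm : M0 ≤ m := Nat.lt_succ_iff.1 (ht.lt_iff_lt.1 (hx.trans_lt hm2))
    refine lt_of_le_of_lt ?_ (hM0 m hMm)
    refine (sol_bound A P D hdiag α hα t v ht m x0 x hm1).trans ?_
    refine mul_le_mul_of_nonneg_right ?_ (norm_nonneg _)
    have h1 : sNorm (P (v m)) ≤ ∑ u, sNorm (P u) :=
      Finset.single_le_sum (f := fun u => sNorm (P u)) (fun u _ => sNorm_nonneg _)
        (Finset.mem_univ (v m))
    have h2 := hexp (v m) (x - t m) (sub_nonneg.2 hm1) (fun h => by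
      have := hH m h
      linarith)
    simp only [← hg]
    have hC0 : 0 ≤ C := hC ▸ mul_nonneg ((sNorm_nonneg _).trans h1) hLpos.le
    refine mul_le_mul
      ((mul_le_mul h1 h2 (Real.exp_pos _).le ((sNorm_nonneg _).trans h1)).trans_eq hC.symm)
      (mul_le_mul_of_nonneg_right (hprod m) (sNorm_nonneg _))
      (mul_nonneg (Finset.prod_nonneg fun j _ => hg0 j) (sNorm_nonneg _)) hC0
  · simpa using hε
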